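/- Suppose z* is a solution at which MFCQ, the second-order condition, and strict complementarity (SC) are satisfied, and fix constants C > 0, γ ∈ (0,1). Then there exist constants c₁ ≥ c₀ > 0, μ̄ > 0 and a neighborhood W of S such that for every triple (z,λ,s) satisfying the approximate centrality conditions with constants C, γ, with (z,λ) ∈ W and μ = λᵀs/m ≤ μ̄: for all i ∈ B, c₀μ ≤ s_i ≤ c₁μ and c₀ ≤ λ_i ≤ c₁; and for all i ∈ N, c₀ ≤ s_i ≤ c₁ and c₀μ ≤ λ_i ≤ c₁μ. -/

import Mathlib

open Matrix
open scoped BigOperators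

noncomputable section

attribute [local instance] Classical.propDecidable

/-- Euclidean norm of a finitely indexed family of real numbers. -/
def evnorm {ι : Type*} [Fintype ι] (v : ι → ℝ) : ℝ :=
  Real.sqrt (∑ i, v i ^ 2)

/-- Frobenius norm of a real matrix. -/
def mnorm {ι κ : Type*} [Fintype ι] [Fintype κ] (M : Matrix ι κ ℝ) : ℝ :=
  Real.sqrt (∑ i, ∑ j, M i j ^ 2)

/-- Smallest singular value of a real matrix. -/
def sigmaMin {ι κ : Type*} [Fintype ι] [Fintype κ] (M : Matrix ι κ ℝ) : ℝ :=
  sInf {t | ∃ x : κ → ℝ, evnorm x = 1 ∧ t = evnorm (M.mulVec x)}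

/-- The continuous linear functional `x ↦ ⟨v, x⟩` on `ℝⁿ`. -/
def dotCLM {n : ℕ} (v : Fin n → ℝ) : (Fin n → ℝ) →L[ℝ] ℝ :=
  ∑ i, v i • (ContinuousLinearMap.proj (R := ℝ) (φ := fun _ : Fin n => ℝ) i)

/-- The continuous linear map `x ↦ M x` on `ℝⁿ`. -/
def matCLM {n : ℕ} (M : Matrix (Fin n) (Fin n) ℝ) : (Fin n → ℝ) →L[ℝ] (Fin n → ℝ) :=
  LinearMap.toContinuousLinearMap (Matrix.toLin' M)

/-- Duality measure `μ(λ,s) = λᵀ s / m`. -/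
def dmu {m : ℕ} (lam s : Fin m → ℝ) : ℝ := (∑ i, lam i * s i) / (m : ℝ)

/-- Data of the nonlinear program `min φ(z)  s.t.  g(z) ≤ 0`, with `φ` and each `gᵢ`
twice Lipschitz continuously differentiable; `gradphi`, `gradg` are the gradients and
`hessphi`, `hessg` the (symmetric) Hessians. -/
structure NLP (n m : ℕ) where
  phi : (Fin n → ℝ) → ℝ
  g : Fin m → (Fin n → ℝ) → ℝ
  gradphi : (Fin n → ℝ) → Fin n → ℝ
  gradg : Fin m → (Fin n → ℝ) → Fin n → ℝ
  hessphi : (Fin n → ℝ) → Matrix (Fin n) (Fin n) ℝ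
  hessg : Fin m → (Fin n → ℝ) → Matrix (Fin n) (Fin n) ℝ
  grad_phi : ∀ z, HasFDerivAt phi (dotCLM (gradphi z)) z
  grad_g : ∀ i z, HasFDerivAt (g i) (dotCLM (gradg i z)) z
  hess_phi : ∀ z, HasFDerivAt gradphi (matCLM (hessphi z)) z
  hess_g : ∀ i z, HasFDerivAt (gradg i) (matCLM (hessg i z)) z
  hessphi_symm : ∀ z, (hessphi z).IsSymm
  hessg_symm : ∀ i z, (hessg i z).IsSymm
  lip_phi : ∃ K, ∀ z z', mnorm (hessphi z - hessphi z') ≤ K * evnorm (z - z')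
  lip_g : ∀ i, ∃ K, ∀ z z', mnorm (hessg i z - hessg i z') ≤ K * evnorm (z - z')

namespace NLP

variable {n m : ℕ} (P : NLP n m)

/-- Gradient of the Lagrangian with respect to `z`:  `L_z(z,λ) = ∇φ(z) + ∇g(z)λ`. -/
def Lz (z : Fin n → ℝ) (lam : Fin m → ℝ) : Fin n → ℝ :=
  fun j => P.gradphi z j + ∑ i, lam i * P.gradg i z j

/-- Hessian of the Lagrangian with respect to `z`. -/
def Lzz (z : Fin n → ℝ) (lam : Fin m → ℝ) : Matrix (Fin n) (Fin n) ℝ :=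
  P.hessphi z + ∑ i, lam i • P.hessg i z

/-- The KKT conditions at `(z, λ)`. -/
def KKT (z : Fin n → ℝ) (lam : Fin m → ℝ) : Prop :=
  P.Lz z lam = 0 ∧ (∀ i, P.g i z ≤ 0) ∧ (∀ i, 0 ≤ lam i) ∧ (∑ i, lam i * P.g i z) = 0

/-- The set `S_λ` of optimal Lagrange multipliers at `z*`. -/
def Slam (zstar : Fin n → ℝ) : Set (Fin m → ℝ) := {lam | P.KKT zstar lam}

/-- The Mangasarian–Fromovitz constraint qualification at `z*`. -/
def MFCQ (zstar : Fin n → ℝ) : Prop :=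
  ∃ ybar : Fin n → ℝ, ∀ i, P.g i zstar = 0 → (∑ j, P.gradg i zstar j * ybar j) < 0

/-- The index set `B₊` of active constraints with a positive multiplier. -/
def BPlus (zstar : Fin n → ℝ) : Set (Fin m) :=
  {i | P.g i zstar = 0 ∧ ∃ ls ∈ P.Slam zstar, 0 < ls i}

/-- The second-order sufficient condition at `z*`. -/
def SOC (zstar : Fin n → ℝ) : Prop :=
  ∃ ξ : ℝ, 0 < ξ ∧ ∀ ls ∈ P.Slam zstar, ∀ w : Fin n → ℝ,
    (∀ i, i ∈ P.BPlus zstar → (∑ j, P.gradg i zstar j * w j) = 0) →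
    (∀ i, P.g i zstar = 0 → i ∉ P.BPlus zstar → (∑ j, P.gradg i zstar j * w j) ≤ 0) →
    ξ * evnorm w ^ 2 ≤ w ⬝ᵥ (P.Lzz zstar ls).mulVec w

/-- The strict complementarity condition `B₊ = B` at `z*`. -/
def StrictComp (zstar : Fin n → ℝ) : Prop :=
  ∀ i, P.g i zstar = 0 → i ∈ P.BPlus zstar

/-- `z*` is a solution of the nonlinear program: it is feasible, it is a local
minimizer, and the first-order KKT conditions hold there. -/
def isSolution (zstar : Fin n → ℝ) : Prop :=
  (∀ i, P.g i zstar ≤ 0) ∧ (∃ lam, P.KKT zstar lam) ∧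
  ∀ᶠ z in nhds zstar, (∀ i, P.g i z ≤ 0) → P.phi zstar ≤ P.phi z

/-- Euclidean distance `δ(z,λ)` from `(z,λ)` to the primal–dual solution set
`S = {z*} × S_λ`. -/
def delta (zstar z : Fin n → ℝ) (lam : Fin m → ℝ) : ℝ :=
  sInf {d | ∃ ls ∈ P.Slam zstar,
    d = Real.sqrt (evnorm (z - zstar) ^ 2 + evnorm (lam - ls) ^ 2)}

/-- The approximate centrality conditions with constants `C`, `γ`. -/
def central (C gam : ℝ) (z : Fin n → ℝ) (lam s : Fin m → ℝ) : Prop :=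
  evnorm (P.Lz z lam) ≤ C * dmu lam s ∧
  evnorm (fun i => P.g i z + s i) ≤ C * dmu lam s ∧
  (∀ i, 0 < lam i) ∧ (∀ i, 0 < s i) ∧ (∀ i, gam * dmu lam s ≤ lam i * s i)

/-- The active index set `B` at `z*`, as a type. -/
abbrev Bsub (zstar : Fin n → ℝ) : Type := {i : Fin m // P.g i zstar = 0}

/-- The inactive index set `N` at `z*`, as a type. -/
abbrev Nsub (zstar : Fin n → ℝ) : Type := {i : Fin m // ¬ P.g i zstar = 0}

/-- `∇g(z)`:  the `n × m` matrix whose columns are the constraint gradients. -/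
def Gfull (z : Fin n → ℝ) : Matrix (Fin n) (Fin m) ℝ :=
  Matrix.of fun j i => P.gradg i z j

/-- `∇g_B(z)`:  the columns of `∇g(z)` indexed by the active set `B` at `z*`. -/
def GB (zstar z : Fin n → ℝ) : Matrix (Fin n) (P.Bsub zstar) ℝ :=
  Matrix.of fun j b => P.gradg b.1 z j

/-- `∇g_N(z)`:  the columns of `∇g(z)` indexed by the inactive set `N` at `z*`. -/
def GN (zstar z : Fin n → ℝ) : Matrix (Fin n) (P.Nsub zstar) ℝ :=
  Matrix.of fun j b => P.gradg b.1 z j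

/-- The diagonal matrix `D_B = Λ_B⁻¹ S_B`. -/
def DB (zstar : Fin n → ℝ) (lam s : Fin m → ℝ) :
    Matrix (P.Bsub zstar) (P.Bsub zstar) ℝ :=
  Matrix.diagonal fun b => s b.1 / lam b.1

/-- The diagonal matrix `D_N = Λ_N⁻¹ S_N`. -/
def DN (zstar : Fin n → ℝ) (lam s : Fin m → ℝ) :
    Matrix (P.Nsub zstar) (P.Nsub zstar) ℝ :=
  Matrix.diagonal fun b => s b.1 / lam b.1

/-- The exact primal–dual step: the solution of the linear system (pdip.orig). -/
def exactStep (z : Fin n → ℝ) (lam s t : Fin m → ℝ) (dz : Fin n → ℝ)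
    (dl ds : Fin m → ℝ) : Prop :=
  (∀ j, ((P.Lzz z lam).mulVec dz) j + ((P.Gfull z).mulVec dl) j = -(P.Lz z lam j)) ∧
  (∀ i, (((P.Gfull z)ᵀ).mulVec dz) i + ds i = -(P.g i z + s i)) ∧
  (∀ i, s i * dl i + lam i * ds i = -(s i * lam i + t i))

end NLP

/-- Part (a) of Assumption A: `z*` is a solution at which MFCQ, the second-order
condition, and strict complementarity hold, and the current iterate `(z,λ,s)`
satisfies the approximate centrality conditions with constants `C`, `γ`. -/
def AssumptionAa {n m : ℕ} (P : NLP n m) (zstar : Fin n → ℝ) (C gam : ℝ)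
    (z : Fin n → ℝ) (lam s : Fin m → ℝ) : Prop :=
  P.isSolution zstar ∧ P.MFCQ zstar ∧ P.SOC zstar ∧ P.StrictComp zstar ∧
  P.central C gam z lam s

/-- The data of a singular value decomposition `∇g_B(z*) = Û Σ Uᵀ`, where the square
matrices `[Û V̂]` (of order `n`) and `[U V]` (of order `|B|`) are orthogonal and `Σ` is
diagonal with positive diagonal entries. -/
structure SVDdata {n m : ℕ} (P : NLP n m) (zstar : Fin n → ℝ) where
  k : ℕ
  kc : ℕ
  r : ℕ
  Uhat : Matrix (Fin n) (Fin k) ℝ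
  Vhat : Matrix (Fin n) (Fin kc) ℝ
  U : Matrix (P.Bsub zstar) (Fin k) ℝ
  V : Matrix (P.Bsub zstar) (Fin r) ℝ
  sig : Fin k → ℝ
  sig_pos : ∀ j, 0 < sig j
  hUhat : Uhatᵀ * Uhat = 1
  hVhat : Vhatᵀ * Vhat = 1
  hUVhat : Uhatᵀ * Vhat = 0
  hhat_complete : Uhat * Uhatᵀ + Vhat * Vhatᵀ = 1
  hU : Uᵀ * U = 1
  hV : Vᵀ * V = 1
  hUV : Uᵀ * V = 0
  h_complete : U * Uᵀ + V * Vᵀ = 1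
  hsvd : P.GB zstar zstar = Uhat * Matrix.diagonal sig * Uᵀ

section

open Filter Topology

lemma norm_le_evnorm {ι : Type*} [Fintype ι] (v : ι → ℝ) : ‖v‖ ≤ evnorm v := by
  refine (pi_norm_le_iff_of_nonneg (Real.sqrt_nonneg _)).2 fun i => ?_
  exact Real.abs_le_sqrt
    (Finset.single_le_sum (f := fun i => v i ^ 2) (fun j _ => sq_nonneg (v j)) (Finset.mem_univ i))

lemma abs_apply_le_norm {ι : Type*} [Fintype ι] (v : ι → ℝ) (i : ι) : |v i| ≤ ‖v‖ :=
  norm_le_pi_norm v i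

lemma abs_dotProduct_le {n : ℕ} (x y : Fin n → ℝ) : |x ⬝ᵥ y| ≤ n * (‖x‖ * ‖y‖) := by
  have h : ∑ i : Fin n, |x i * y i| ≤ ∑ _i : Fin n, ‖x‖ * ‖y‖ := by
    refine Finset.sum_le_sum fun i _ => ?_
    rw [abs_mul]
    exact mul_le_mul (abs_apply_le_norm x i) (abs_apply_le_norm y i) (abs_nonneg _) (norm_nonneg _)
  refine (Finset.abs_sum_le_sum_abs _ _).trans (h.trans ?_)
  simp

lemma dotCLM_apply {n : ℕ} (v x : Fin n → ℝ) : dotCLM v x = v ⬝ᵥ x := by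
  simp [dotCLM, dotProduct]

lemma matCLM_apply {n : ℕ} (M : Matrix (Fin n) (Fin n) ℝ) (x : Fin n → ℝ) :
    matCLM M x = M *ᵥ x := by
  simp [matCLM]

lemma norm_dotCLM_le {n : ℕ} (v : Fin n → ℝ) : ‖dotCLM v‖ ≤ n * ‖v‖ := by
  refine ContinuousLinearMap.opNorm_le_bound _ (by positivity) fun x => ?_
  rw [dotCLM_apply, Real.norm_eq_abs]
  linarith [abs_dotProduct_le v x]

/-- A differentiable map is approximated by its linearization up to an arbitrarily small multiple
of the displacement. -/
lemma eventually_norm_sub_mulVec_le {n : ℕ} {f : (Fin n → ℝ) → Fin n → ℝ}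
    {M : Matrix (Fin n) (Fin n) ℝ} {a : Fin n → ℝ} (hf : HasFDerivAt f (matCLM M) a)
    {η : ℝ} (hη : 0 < η) :
    ∀ᶠ z in 𝓝 a, ‖f z - f a - M *ᵥ (z - a)‖ ≤ η * ‖z - a‖ := by
  have h := hf.isLittleO.def hη
  simpa only [matCLM_apply] using h

lemma exists_eventually_norm_sub_le {n : ℕ} {f : (Fin n → ℝ) → Fin n → ℝ}
    {M : Matrix (Fin n) (Fin n) ℝ} {a : Fin n → ℝ} (hf : HasFDerivAt f (matCLM M) a) :
    ∃ K, 0 ≤ K ∧ ∀ᶠ z in 𝓝 a, ‖f z - f a‖ ≤ K * ‖z - a‖ := by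
  obtain ⟨K, hK, h⟩ := hf.isBigO_sub.exists_nonneg
  exact ⟨K, hK, h.bound⟩

/-- Second-order remainder estimate for a function whose gradient is differentiable at `a`. -/
lemma exists_eventually_taylor_le {n : ℕ} {f : (Fin n → ℝ) → ℝ} {G : (Fin n → ℝ) → Fin n → ℝ}
    {M : Matrix (Fin n) (Fin n) ℝ} {a : Fin n → ℝ} (hf : ∀ z, HasFDerivAt f (dotCLM (G z)) z)
    (hG : HasFDerivAt G (matCLM M) a) :
    ∃ K, 0 ≤ K ∧ ∀ᶠ z in 𝓝 a, |f z - f a - G a ⬝ᵥ (z - a)| ≤ K * ‖z - a‖ ^ 2 ∧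
      |f z - f a - G z ⬝ᵥ (z - a)| ≤ K * ‖z - a‖ ^ 2 := by
  obtain ⟨K, hK, h⟩ := exists_eventually_norm_sub_le hG
  refine ⟨2 * (n * K), by positivity, ?_⟩
  obtain ⟨δ, hδ, hball⟩ := Metric.eventually_nhds_iff.1 h
  refine Metric.eventually_nhds_iff.2 ⟨δ, hδ, fun z hz => ?_⟩
  have key : |f z - f a - G a ⬝ᵥ (z - a)| ≤ n * K * ‖z - a‖ ^ 2 := by
    have := (convex_closedBall a ‖z - a‖).norm_image_sub_le_of_norm_hasFDerivWithin_le'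
      (f := f) (f' := fun x => dotCLM (G x)) (φ := dotCLM (G a)) (C := n * (K * ‖z - a‖))
      (x := a) (y := z)
      (fun x _ => (hf x).hasFDerivWithinAt) (fun x hx => ?_)
      (by simp) (by simp [dist_eq_norm])
    · rw [dotCLM_apply, Real.norm_eq_abs] at this
      linarith
    · have hx' : dist x a ≤ ‖z - a‖ := hx
      have hsub : dotCLM (G x) - dotCLM (G a) = dotCLM (G x - G a) := by
        ext y; simp [dotCLM_apply, sub_dotProduct]
      rw [hsub]
      refine (norm_dotCLM_le _).trans ?_
      have h1 := hball (y := x) (hx'.trans_lt (by rwa [← dist_eq_norm]))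
      rw [dist_eq_norm] at hx'
      gcongr
      exact h1.trans (by gcongr)
  have h2 : |(G z - G a) ⬝ᵥ (z - a)| ≤ n * K * ‖z - a‖ ^ 2 := by
    refine (abs_dotProduct_le _ _).trans ?_
    have := mul_le_mul_of_nonneg_right (hball hz) (norm_nonneg (z - a))
    calc (n : ℝ) * (‖G z - G a‖ * ‖z - a‖) ≤ n * (K * ‖z - a‖ * ‖z - a‖) := by gcongr
      _ = _ := by ring
  refine ⟨key.trans ?_, ?_⟩
  · nlinarith [abs_nonneg (f z - f a - G a ⬝ᵥ (z - a))]
  · have : f z - f a - G z ⬝ᵥ (z - a) =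
        (f z - f a - G a ⬝ᵥ (z - a)) - (G z - G a) ⬝ᵥ (z - a) := by
      rw [sub_dotProduct]; ring
    rw [this]
    refine (abs_sub _ _).trans ?_
    linarith

/-- The distance to the kernel of a linear map is bounded by the norm of the image. -/
lemma exists_mem_ker_norm_sub_le {n m : ℕ} (A : (Fin n → ℝ) →ₗ[ℝ] (Fin m → ℝ)) :
    ∃ K, 0 ≤ K ∧ ∀ d, ∃ v, A v = 0 ∧ ‖d - v‖ ≤ K * ‖A d‖ := by
  obtain ⟨r, hr⟩ := A.rangeRestrict.exists_rightInverse_of_surjective A.range_rangeRestrict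
  obtain ⟨K, hK, hr'⟩ := (LinearMap.toContinuousLinearMap r).bound
  refine ⟨K, hK.le, fun d => ⟨d - r (A.rangeRestrict d), ?_, ?_⟩⟩
  · have : A (r (A.rangeRestrict d)) = A d :=
      congrArg Subtype.val (LinearMap.congr_fun hr (A.rangeRestrict d))
    rw [map_sub, this, sub_self]
  · rw [sub_sub_cancel]
    exact hr' (A.rangeRestrict d)

/-- Bounds for finitely many families can be chosen uniformly. -/
lemma exists_uniform_bound {ι : Type*} [Fintype ι] {p : ι → ℝ → Prop}
    (hp : ∀ i, ∃ K, p i K) (hmono : ∀ i K K', K ≤ K' → p i K → p i K') :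
    ∃ K, 0 ≤ K ∧ ∀ i, p i K := by
  choose k hk using hp
  refine ⟨∑ i, |k i|, Finset.sum_nonneg fun _ _ => abs_nonneg _, fun i => hmono i _ _ ?_ (hk i)⟩
  exact (le_abs_self _).trans
    (Finset.single_le_sum (f := fun i => |k i|) (fun _ _ => abs_nonneg _) (Finset.mem_univ i))

lemma exists_abs_dotProduct_mulVec_le {n : ℕ} (M : Matrix (Fin n) (Fin n) ℝ) :
    ∃ K, ∀ x y, |x ⬝ᵥ M *ᵥ y| ≤ K * (‖x‖ * ‖y‖) := by
  obtain ⟨K, hK, h⟩ := (matCLM M).bound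
  refine ⟨n * K, fun x y => (abs_dotProduct_le _ _).trans ?_⟩
  have := h y
  rw [matCLM_apply] at this
  calc (n : ℝ) * (‖x‖ * ‖M *ᵥ y‖) ≤ n * (‖x‖ * (K * ‖y‖)) := by gcongr
    _ = _ := by ring

lemma sum_mul_eq_mul_dmu {m : ℕ} (lam s : Fin m → ℝ) :
    ∑ i, lam i * s i = m * dmu lam s := by
  rcases Nat.eq_zero_or_pos m with rfl | hm
  · simp
  · rw [dmu, mul_div_cancel₀]
    exact_mod_cast hm.ne'

namespace NLP

variable {n m : ℕ} (P : NLP n m)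

/-- The triple `(z, lam, s)` satisfies the approximate centrality conditions with duality measure
at most `ε`, and `(z, lam)` lies within `ε` of the primal-dual solution `(zstar, ls)`. -/
structure NearCentral (zstar : Fin n → ℝ) (C gam ε : ℝ) (z : Fin n → ℝ)
    (lam ls s : Fin m → ℝ) : Prop where
  mem : ls ∈ P.Slam zstar
  primal : ‖z - zstar‖ < ε
  dual : ‖lam - ls‖ < ε
  central : P.central C gam z lam s
  dmu_le : dmu lam s ≤ ε

variable {P} {zstar z : Fin n → ℝ} {C gam ε ε' : ℝ} {lam ls s : Fin m → ℝ}

lemma NearCentral.mono (h : P.NearCentral zstar C gam ε z lam ls s) (hε : ε ≤ ε') :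
    P.NearCentral zstar C gam ε' z lam ls s :=
  ⟨h.mem, h.primal.trans_le hε, h.dual.trans_le hε, h.central, h.dmu_le.trans hε⟩

lemma central.dmu_nonneg (h : P.central C gam z lam s) : 0 ≤ dmu lam s :=
  div_nonneg (Finset.sum_nonneg fun i _ => (mul_pos (h.2.2.1 i) (h.2.2.2.1 i)).le)
    (Nat.cast_nonneg m)

lemma central.mul_le (h : P.central C gam z lam s) (i : Fin m) :
    lam i * s i ≤ m * dmu lam s := by
  rw [← sum_mul_eq_mul_dmu]
  exact Finset.single_le_sum (f := fun i => lam i * s i)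
    (fun j _ => (mul_pos (h.2.2.1 j) (h.2.2.2.1 j)).le) (Finset.mem_univ i)

lemma central.abs_add_le (h : P.central C gam z lam s) (i : Fin m) :
    |P.g i z + s i| ≤ C * dmu lam s :=
  (abs_apply_le_norm (fun i => P.g i z + s i) i).trans ((norm_le_evnorm _).trans h.2.1)

lemma Lz_dotProduct (z : Fin n → ℝ) (lam : Fin m → ℝ) (d : Fin n → ℝ) :
    P.Lz z lam ⬝ᵥ d = P.gradphi z ⬝ᵥ d + ∑ i, lam i * (P.gradg i z ⬝ᵥ d) := by
  have : P.Lz z lam = P.gradphi z + ∑ i, lam i • P.gradg i z := by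
    ext j; simp [Lz]
  rw [this, add_dotProduct, sum_dotProduct]
  simp

lemma dotProduct_Lzz_mulVec (z : Fin n → ℝ) (lam : Fin m → ℝ) (x y : Fin n → ℝ) :
    x ⬝ᵥ P.Lzz z lam *ᵥ y =
      x ⬝ᵥ P.hessphi z *ᵥ y + ∑ i, lam i * (x ⬝ᵥ P.hessg i z *ᵥ y) := by
  rw [Lzz, add_mulVec, dotProduct_add, sum_mulVec, dotProduct_sum]
  simp [smul_mulVec]

lemma multiplier_eq_zero (h : ls ∈ P.Slam zstar) {i : Fin m} (hi : P.g i zstar ≠ 0) :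
    ls i = 0 := by
  have h1 : ∀ j ∈ Finset.univ, ls j * P.g j zstar ≤ 0 := fun j _ =>
    mul_nonpos_of_nonneg_of_nonpos (h.2.2.1 j) (h.2.1 j)
  have := (Finset.sum_eq_zero_iff_of_nonpos h1).1 h.2.2.2 i (Finset.mem_univ i)
  exact (mul_eq_zero.1 this).resolve_right hi

lemma multiplier_stationary (h : ls ∈ P.Slam zstar) (d : Fin n → ℝ) :
    P.gradphi zstar ⬝ᵥ d + ∑ i, ls i * (P.gradg i zstar ⬝ᵥ d) = 0 := by
  rw [← Lz_dotProduct, h.1, zero_dotProduct]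

/-- Under MFCQ the set of multipliers is bounded. -/
lemma MFCQ.exists_multiplier_le (h : P.MFCQ zstar) :
    ∃ M, 0 ≤ M ∧ ∀ i, ∀ ls ∈ P.Slam zstar, ls i ≤ M := by
  obtain ⟨y, hy⟩ := h
  refine exists_uniform_bound (fun i => ?_) fun i K K' hK h ls hls => (h ls hls).trans hK
  by_cases hi : P.g i zstar = 0
  · have hyi : P.gradg i zstar ⬝ᵥ y < 0 := hy i hi
    refine ⟨(P.gradphi zstar ⬝ᵥ y) / (-(P.gradg i zstar ⬝ᵥ y)), fun ls hls => ?_⟩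
    rw [le_div_iff₀ (by linarith)]
    have h1 : ∀ j ∈ Finset.univ, 0 ≤ -(ls j * (P.gradg j zstar ⬝ᵥ y)) := fun j _ => by
      by_cases hj : P.g j zstar = 0
      · have : P.gradg j zstar ⬝ᵥ y < 0 := hy j hj
        nlinarith [hls.2.2.1 j]
      · simp [multiplier_eq_zero hls hj]
    have h2 := Finset.single_le_sum h1 (Finset.mem_univ i)
    rw [Finset.sum_neg_distrib] at h2
    linarith [multiplier_stationary hls y]
  · exact ⟨0, fun ls hls => (multiplier_eq_zero hls hi).le⟩

lemma exists_constraint_taylor_le (P : NLP n m) (zstar : Fin n → ℝ) :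
    ∃ K, 0 ≤ K ∧ ∃ ε, 0 < ε ∧ ∀ z, ‖z - zstar‖ < ε → ∀ i,
      |P.g i z - P.g i zstar - P.gradg i zstar ⬝ᵥ (z - zstar)| ≤ K * ‖z - zstar‖ ^ 2 ∧
      |P.g i z - P.g i zstar - P.gradg i z ⬝ᵥ (z - zstar)| ≤ K * ‖z - zstar‖ ^ 2 := by
  obtain ⟨K, hK, h⟩ := exists_uniform_bound
    (fun i => (exists_eventually_taylor_le (P.grad_g i) (P.hess_g i zstar)).imp fun _ h => h.2)
    (fun i K K' hKK' h => by
      filter_upwards [h] with z hz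
      exact ⟨hz.1.trans (by gcongr), hz.2.trans (by gcongr)⟩)
  obtain ⟨ε, hε, h'⟩ := Metric.eventually_nhds_iff.1 (eventually_all.2 h)
  exact ⟨K, hK, ε, hε, fun z hz => h' (by rwa [dist_eq_norm])⟩

lemma exists_constraint_sub_le (P : NLP n m) (zstar : Fin n → ℝ) {η : ℝ} (hη : 0 < η) :
    ∃ ε, 0 < ε ∧ ∀ z, ‖z - zstar‖ < ε → ∀ i, |P.g i z - P.g i zstar| ≤ η := by
  have h : ∀ i, ∀ᶠ z in 𝓝 zstar, |P.g i z - P.g i zstar| ≤ η := fun i => by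
    filter_upwards [(P.grad_g i zstar).continuousAt.eventually (Metric.ball_mem_nhds _ hη)]
      with z hz
    exact (Real.dist_eq _ _ ▸ Metric.mem_ball.1 hz).le
  obtain ⟨ε, hε, h'⟩ := Metric.eventually_nhds_iff.1 (eventually_all.2 h)
  exact ⟨ε, hε, fun z hz => h' (by rwa [dist_eq_norm])⟩

/-- Slacks of inactive constraints are bounded and bounded away from zero. -/
lemma exists_inactive_slack_bounds (hfeas : ∀ i, P.g i zstar ≤ 0) (hC : 0 < C) :
    ∃ a b ε, 0 < a ∧ a ≤ b ∧ 0 < ε ∧ ∀ z lam ls s, P.NearCentral zstar C gam ε z lam ls s →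
      ∀ i, P.g i zstar ≠ 0 → a ≤ s i ∧ s i ≤ b := by
  obtain ⟨K, hK, h⟩ := exists_uniform_bound (ι := Fin m)
    (p := fun i K => P.g i zstar ≠ 0 → 1 ≤ K * (-P.g i zstar))
    (fun i => ⟨1 / (-P.g i zstar), fun hi => by
      rw [div_mul_cancel₀ _ (neg_ne_zero.2 hi)]⟩)
    (fun i K K' hK h hi => (h hi).trans (by have := hfeas i; gcongr; linarith))
  obtain ⟨b, hb, hgb⟩ := exists_uniform_bound (ι := Fin m) (p := fun i K => -P.g i zstar ≤ K)
    (fun i => ⟨_, le_rfl⟩) (fun i K K' hK h => h.trans hK)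
  have hK1 : 0 < K + 1 := by linarith
  set a : ℝ := 1 / (4 * (K + 1)) with ha
  have ha0 : 0 < a := by positivity
  obtain ⟨ε, hε, hcont⟩ := P.exists_constraint_sub_le zstar ha0
  refine ⟨a, b + 3 * a, min ε (a / C), ha0, by linarith, by positivity, ?_⟩
  intro z lam ls s hnear i hi
  have h1 := abs_le.1 (hcont z (hnear.mono (min_le_left _ _)).primal i)
  have h2 := abs_le.1 (hnear.central.abs_add_le i)
  have h3 : C * dmu lam s ≤ a := by
    have := (hnear.mono (min_le_right _ _)).dmu_le
    rw [le_div_iff₀ hC] at this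
    linarith
  have h4 : 4 * a ≤ -P.g i zstar := by
    have h5 : 4 * a = 1 / (K + 1) := by rw [ha]; field_simp
    rw [h5, div_le_iff₀ hK1]
    nlinarith [h i hi, hfeas i]
  have h6 := hgb i
  constructor <;> linarith [h1.1, h1.2, h2.1, h2.2]

/-- A uniform approximation of the objective and constraint gradients by their linearizations. -/
lemma exists_gradient_approx (P : NLP n m) (zstar : Fin n → ℝ) {η : ℝ} (hη : 0 < η) :
    ∃ ε, 0 < ε ∧ ∀ z, ‖z - zstar‖ < ε →
      ‖P.gradphi z - P.gradphi zstar - P.hessphi zstar *ᵥ (z - zstar)‖ ≤ η * ‖z - zstar‖ ∧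
      ∀ i, ‖P.gradg i z - P.gradg i zstar - P.hessg i zstar *ᵥ (z - zstar)‖ ≤
        η * ‖z - zstar‖ := by
  obtain ⟨ε, hε, h'⟩ := Metric.eventually_nhds_iff.1
    ((eventually_norm_sub_mulVec_le (P.hess_phi zstar) hη).and
      (eventually_all.2 fun i => eventually_norm_sub_mulVec_le (P.hess_g i zstar) hη))
  exact ⟨ε, hε, fun z hz => h' (by rwa [dist_eq_norm])⟩

lemma exists_Lzz_bound (hmfcq : P.MFCQ zstar) :
    ∃ h, 0 ≤ h ∧ ∀ ls ∈ P.Slam zstar, ∀ x y,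
      |x ⬝ᵥ P.Lzz zstar ls *ᵥ y| ≤ h * (‖x‖ * ‖y‖) := by
  obtain ⟨M, hM, hls⟩ := hmfcq.exists_multiplier_le
  obtain ⟨k, hk⟩ := exists_abs_dotProduct_mulVec_le (P.hessphi zstar)
  obtain ⟨K, hK, h⟩ := exists_uniform_bound
    (fun i => exists_abs_dotProduct_mulVec_le (P.hessg i zstar))
    (fun i K K' hKK' h x y => (h x y).trans (by gcongr))
  refine ⟨|k| + m * (M * K), by positivity, fun ls hmem x y => ?_⟩
  rw [dotProduct_Lzz_mulVec]
  have h1 : |∑ i, ls i * (x ⬝ᵥ P.hessg i zstar *ᵥ y)| ≤ ∑ _i : Fin m, M * (K * (‖x‖ * ‖y‖)) := by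
    refine (Finset.abs_sum_le_sum_abs _ _).trans (Finset.sum_le_sum fun i _ => ?_)
    rw [abs_mul, abs_of_nonneg (hmem.2.2.1 i)]
    exact mul_le_mul (hls i ls hmem) (h i x y) (abs_nonneg _) hM
  have h2 : |x ⬝ᵥ P.hessphi zstar *ᵥ y| ≤ |k| * (‖x‖ * ‖y‖) :=
    (hk x y).trans (by gcongr; exact le_abs_self k)
  refine (abs_add_le _ _).trans ((add_le_add h2 h1).trans (le_of_eq ?_))
  simp
  ring

/-- First-order estimate at a nearly central point, with complementarity folded in. -/
lemma exists_curvature_add_slack_le (hfeas : ∀ i, P.g i zstar ≤ 0) (hmfcq : P.MFCQ zstar)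
    (hC : 0 < C) :
    ∃ K, 0 ≤ K ∧ ∀ η, 0 < η → ∃ ε, 0 < ε ∧ ∀ z lam ls s, P.NearCentral zstar C gam ε z lam ls s →
      (z - zstar) ⬝ᵥ P.Lzz zstar ls *ᵥ (z - zstar) + ∑ i, ls i * s i ≤
        K * dmu lam s + η * ‖z - zstar‖ ^ 2 := by
  obtain ⟨M, hM, hbound⟩ := hmfcq.exists_multiplier_le
  obtain ⟨T, hT, ε₁, hε₁, htaylor⟩ := P.exists_constraint_taylor_le zstar
  obtain ⟨ε₂, hε₂, hcont⟩ := P.exists_constraint_sub_le zstar one_pos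
  obtain ⟨a, b, ε₃, ha, -, hε₃, hslack⟩ := exists_inactive_slack_bounds (gam := gam) hfeas hC
  set K₂ : ℝ := C + m / a * (1 + T) with hK₂
  refine ⟨n * C + m + m * K₂, by positivity, fun η hη => ?_⟩
  set η' : ℝ := η / (2 * (n * (1 + m * M) + 1)) with hη'
  have hη'0 : 0 < η' := by positivity
  obtain ⟨ε₄, hε₄, happrox⟩ := P.exists_gradient_approx zstar hη'0
  set ρ : ℝ := η / (2 * (m * T + 1)) with hρ
  have hρ0 : 0 < ρ := by positivity
  refine ⟨min ε₁ (min ε₂ (min ε₃ (min ε₄ (min 1 ρ)))), by positivity, ?_⟩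
  intro z lam ls s hnear
  obtain ⟨h₁, h⟩ : P.NearCentral zstar C gam ε₁ z lam ls s ∧ P.NearCentral zstar C gam
    (min ε₂ (min ε₃ (min ε₄ (min 1 ρ)))) z lam ls s :=
    ⟨hnear.mono (min_le_left _ _), hnear.mono (min_le_right _ _)⟩
  obtain ⟨h₂, h⟩ := And.intro (h.mono (min_le_left _ _)) (h.mono (min_le_right _ _))
  obtain ⟨h₃, h⟩ := And.intro (h.mono (min_le_left _ _)) (h.mono (min_le_right _ _))
  obtain ⟨h₄, h⟩ := And.intro (h.mono (min_le_left _ _)) (h.mono (min_le_right _ _))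
  obtain ⟨h₅, h₆⟩ := And.intro (h.mono (min_le_left _ _)) (h.mono (min_le_right _ _))
  have hcen := hnear.central
  have hmem := hnear.mem
  have hmu := hcen.dmu_nonneg
  have hq1 := h₅.primal.le
  have hr1 := h₅.dual.le
  have hrρ := h₆.dual.le
  have hadd := hcen.abs_add_le
  have hmul := hcen.mul_le
  have htay := htaylor z h₁.primal
  have hct := hcont z h₂.primal
  have hsl := hslack z lam ls s h₃
  have hap := happrox z h₄.primal
  have hlz : |P.Lz z lam ⬝ᵥ (z - zstar)| ≤ n * (C * dmu lam s) := by
    refine (abs_dotProduct_le _ _).trans ?_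
    have := (norm_le_evnorm _).trans hcen.1
    have h7 : ‖P.Lz z lam‖ * ‖z - zstar‖ ≤ C * dmu lam s * 1 :=
      mul_le_mul this hq1 (norm_nonneg _) (by positivity)
    rw [mul_one] at h7
    gcongr
  set d := z - zstar with hd
  set μ := dmu lam s with hμ
  set q := ‖d‖ with hq
  have hq0 : 0 ≤ q := norm_nonneg _
  have hterm : ∀ i, -(lam i * s i) + ls i * s i - (K₂ * μ + ρ * (T * q ^ 2)) ≤
      (lam i - ls i) * (P.gradg i z ⬝ᵥ d) := by
    intro i
    have hdi : |lam i - ls i| ≤ ‖lam - ls‖ := abs_apply_le_norm (lam - ls) i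
    have hti := (htay i).2
    by_cases hi : P.g i zstar = 0
    · rw [hi, sub_zero] at hti
      have e1 : |(lam i - ls i) * (P.g i z + s i)| ≤ 1 * (C * μ) := by
        rw [abs_mul]
        exact mul_le_mul (hdi.trans hr1) (hadd i) (abs_nonneg _) zero_le_one
      have e2 : |(lam i - ls i) * (P.g i z - P.gradg i z ⬝ᵥ d)| ≤ ρ * (T * q ^ 2) := by
        rw [abs_mul]
        exact mul_le_mul (hdi.trans hrρ) hti (abs_nonneg _) hρ0.le
      have e3 : 0 ≤ m / a * (1 + T) * μ := by positivity
      have e4 := (abs_le.1 e1).1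
      have e5 := (abs_le.1 e2).2
      rw [hK₂]
      linarith
    · rw [multiplier_eq_zero hmem hi, sub_zero, zero_mul]
      have e1 : lam i ≤ m / a * μ := by
        rw [div_mul_eq_mul_div, le_div_iff₀ ha]
        exact (mul_le_mul_of_nonneg_left (hsl i hi).1 (hcen.2.2.1 i).le).trans (hmul i)
      have e2 : |P.gradg i z ⬝ᵥ d| ≤ 1 + T := by
        have e6 : T * q ^ 2 ≤ T := by nlinarith [mul_le_mul hq1 hq1 hq0 zero_le_one]
        have e7 := abs_le.1 (hct i)
        have e8 := abs_le.1 hti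
        rw [abs_le]
        constructor <;> linarith
      have e3 : |lam i * (P.gradg i z ⬝ᵥ d)| ≤ m / a * μ * (1 + T) := by
        rw [abs_mul, abs_of_pos (hcen.2.2.1 i)]
        exact mul_le_mul e1 e2 (abs_nonneg _) (by positivity)
      have e4 := (abs_le.1 e3).1
      have e5 := mul_pos (hcen.2.2.1 i) (hcen.2.2.2.1 i)
      have e6 : 0 ≤ ρ * (T * q ^ 2) := by positivity
      have e7 : 0 ≤ C * μ := by positivity
      rw [hK₂]
      linarith
  have hsum := Finset.sum_le_sum fun i (_ : i ∈ Finset.univ) => hterm i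
  simp only [Finset.sum_sub_distrib, Finset.sum_add_distrib, Finset.sum_neg_distrib,
    sum_mul_eq_mul_dmu lam s, Finset.sum_const, Finset.card_univ, Fintype.card_fin,
    nsmul_eq_mul] at hsum
  set e₀ := (P.gradphi z - P.gradphi zstar - P.hessphi zstar *ᵥ d) ⬝ᵥ d with he₀
  have he₀_le : |e₀| ≤ n * (η' * q * q) := by
    refine (abs_dotProduct_le _ _).trans ?_
    have := hap.1
    gcongr
  have he_le : |∑ i, ls i * ((P.gradg i z - P.gradg i zstar - P.hessg i zstar *ᵥ d) ⬝ᵥ d)| ≤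
      ∑ _i : Fin m, M * (n * (η' * q * q)) := by
    refine (Finset.abs_sum_le_sum_abs _ _).trans (Finset.sum_le_sum fun i _ => ?_)
    rw [abs_mul, abs_of_nonneg (hmem.2.2.1 i)]
    refine mul_le_mul (hbound i ls hmem) ((abs_dotProduct_le _ _).trans ?_) (abs_nonneg _) hM
    have := hap.2 i
    gcongr
  simp only [Finset.sum_const, Finset.card_univ, Fintype.card_fin, nsmul_eq_mul] at he_le
  have hident : d ⬝ᵥ P.Lzz zstar ls *ᵥ d = P.Lz z lam ⬝ᵥ d - e₀ -
      ∑ i, ls i * ((P.gradg i z - P.gradg i zstar - P.hessg i zstar *ᵥ d) ⬝ᵥ d) -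
      ∑ i, (lam i - ls i) * (P.gradg i z ⬝ᵥ d) := by
    have h0 := multiplier_stationary hmem d
    have e1 : P.Lz z lam ⬝ᵥ d = P.Lz z lam ⬝ᵥ d -
      (P.gradphi zstar ⬝ᵥ d + ∑ i, ls i * (P.gradg i zstar ⬝ᵥ d)) := by rw [h0, sub_zero]
    rw [e1, Lz_dotProduct, dotProduct_Lzz_mulVec, he₀]
    simp only [dotProduct_comm _ d, dotProduct_sub, mul_sub, sub_mul, Finset.sum_sub_distrib]
    ring
  have e1 := (abs_le.1 hlz).2
  have e2 := (abs_le.1 he₀_le).1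
  have e3 := (abs_le.1 he_le).1
  have e4 : n * (η' * q * q) + m * (M * (n * (η' * q * q))) ≤ η / 2 * q ^ 2 := by
    have : n * (η' * q * q) + m * (M * (n * (η' * q * q))) =
        η' * (n * (1 + m * M)) * q ^ 2 := by ring
    rw [this]
    gcongr
    rw [hη', div_mul_eq_mul_div, div_le_div_iff₀ (by positivity) two_pos]
    nlinarith
  have e5 : m * (ρ * (T * q ^ 2)) ≤ η / 2 * q ^ 2 := by
    have : m * (ρ * (T * q ^ 2)) = ρ * (m * T) * q ^ 2 := by ring
    rw [this]
    gcongr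
    rw [hρ, div_mul_eq_mul_div, div_le_div_iff₀ (by positivity) two_pos]
    nlinarith
  rw [hident]
  linarith

/-- Under strict complementarity, slacks of active constraints are of the order of the duality
measure plus the squared primal distance. -/
lemma exists_active_slack_le_add_sq (hfeas : ∀ i, P.g i zstar ≤ 0) (hmfcq : P.MFCQ zstar)
    (hsc : P.StrictComp zstar) (hC : 0 < C) :
    ∃ K, 0 ≤ K ∧ ∃ ε, 0 < ε ∧ ∀ z lam ls s, P.NearCentral zstar C gam ε z lam ls s →
      ∀ i, P.g i zstar = 0 → s i ≤ K * (dmu lam s + ‖z - zstar‖ ^ 2) ∧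
        |P.gradg i zstar ⬝ᵥ (z - zstar)| ≤ K * (dmu lam s + ‖z - zstar‖ ^ 2) := by
  obtain ⟨M, hM, hbound⟩ := hmfcq.exists_multiplier_le
  obtain ⟨T, hT, ε₁, hε₁, htaylor⟩ := P.exists_constraint_taylor_le zstar
  obtain ⟨h, hh, hLzz⟩ := exists_Lzz_bound hmfcq
  obtain ⟨K₁, hK₁, hfirst⟩ := exists_curvature_add_slack_le (gam := gam) hfeas hmfcq hC
  obtain ⟨ε₂, hε₂, hfirst⟩ := hfirst 1 one_pos
  obtain ⟨L, hL, hpos⟩ := exists_uniform_bound (ι := Fin m)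
    (p := fun i K => P.g i zstar = 0 → ∃ ls ∈ P.Slam zstar, 1 ≤ K * ls i)
    (fun i => by
      by_cases hi : P.g i zstar = 0
      · obtain ⟨-, ls, hls, hlsi⟩ := hsc i hi
        exact ⟨1 / ls i, fun _ => ⟨ls, hls, by rw [div_mul_cancel₀ _ hlsi.ne']⟩⟩
      · exact ⟨0, fun h => absurd h hi⟩)
    (fun i K K' hK h hi => by
      obtain ⟨ls, hls, h1⟩ := h hi
      exact ⟨ls, hls, h1.trans (mul_le_mul_of_nonneg_right hK (hls.2.2.1 i))⟩)
  set K₂ : ℝ := K₁ + 1 + h + m * (M * (C + T)) with hK₂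
  have hK₂0 : 0 ≤ K₂ := by positivity
  refine ⟨L * K₂ + (C + T + L * K₂), by positivity, min ε₁ ε₂, by positivity, ?_⟩
  intro z lam ls s hnear i hi
  have hcen := hnear.central
  have hmem := hnear.mem
  have hmu := hcen.dmu_nonneg
  have htay := htaylor z (hnear.mono (min_le_left _ _)).primal
  have hf := hfirst z lam ls s (hnear.mono (min_le_right _ _))
  have hdd := (abs_le.1 (hLzz ls hmem (z - zstar) (z - zstar))).1
  have hadd := hcen.abs_add_le
  set d := z - zstar with hd
  set μ := dmu lam s with hμ
  set q := ‖d‖ with hq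
  have hq0 : 0 ≤ q := norm_nonneg _
  have hX : 0 ≤ μ + q ^ 2 := by positivity
  have herr : ∀ j, P.g j zstar = 0 → |P.gradg j zstar ⬝ᵥ d + s j| ≤ (C + T) * (μ + q ^ 2) := by
    intro j hj
    have e1 := abs_le.1 (htay j).1
    have e2 := abs_le.1 (hadd j)
    rw [hj] at e1
    have e3 : 0 ≤ C * q ^ 2 := by positivity
    have e4 : 0 ≤ T * μ := by positivity
    rw [abs_le]
    constructor <;> linarith
  obtain ⟨lt, hlt, hlti⟩ := hpos i hi
  have hsum_le : ∑ j, lt j * s j ≤ K₂ * (μ + q ^ 2) := by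
    have e1 : ∑ j, lt j * s j = ∑ j, ls j * s j +
        ∑ j, (lt j - ls j) * (P.gradg j zstar ⬝ᵥ d + s j) := by
      have e2 := multiplier_stationary hlt d
      have e3 := multiplier_stationary hmem d
      simp only [sub_mul, mul_add, Finset.sum_sub_distrib, Finset.sum_add_distrib]
      linarith
    have e2 : ∑ j, (lt j - ls j) * (P.gradg j zstar ⬝ᵥ d + s j) ≤
        ∑ _j : Fin m, M * ((C + T) * (μ + q ^ 2)) := by
      refine Finset.sum_le_sum fun j _ => ?_
      by_cases hj : P.g j zstar = 0
      · refine (le_abs_self _).trans ?_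
        rw [abs_mul]
        refine mul_le_mul (abs_le.2 ⟨?_, ?_⟩) (herr j hj) (abs_nonneg _) hM
        · linarith [hbound j ls hmem, hlt.2.2.1 j]
        · linarith [hbound j lt hlt, hmem.2.2.1 j]
      · rw [multiplier_eq_zero hlt hj, multiplier_eq_zero hmem hj, sub_zero, zero_mul]
        positivity
    simp only [Finset.sum_const, Finset.card_univ, Fintype.card_fin, nsmul_eq_mul] at e2
    have e3 : 0 ≤ K₁ * q ^ 2 := by positivity
    have e4 : 0 ≤ h * μ := by positivity
    rw [hK₂]
    linarith
  have hs : s i ≤ L * K₂ * (μ + q ^ 2) := by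
    have e1 : lt i * s i ≤ ∑ j, lt j * s j :=
      Finset.single_le_sum (f := fun j => lt j * s j)
        (fun j _ => mul_nonneg (hlt.2.2.1 j) (hcen.2.2.2.1 j).le) (Finset.mem_univ i)
    calc s i ≤ L * lt i * s i := le_mul_of_one_le_left (hcen.2.2.2.1 i).le hlti
      _ = L * (lt i * s i) := by ring
      _ ≤ L * (K₂ * (μ + q ^ 2)) := mul_le_mul_of_nonneg_left (e1.trans hsum_le) hL
      _ = _ := by ring
  have e1 := abs_le.1 (herr i hi)
  have e2 : 0 ≤ (C + T) * (μ + q ^ 2) := by positivity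
  have e3 : 0 ≤ L * K₂ * (μ + q ^ 2) := by positivity
  have e4 := hcen.2.2.2.1 i
  refine ⟨by linarith, abs_le.2 ⟨?_, ?_⟩⟩ <;> linarith [e1.1, e1.2]

/-- Scalar form of the second-order argument: `q`, `r`, `p` are the lengths of a vector, of its
component in the critical subspace, and of the remainder; `D` is the curvature along the vector. -/
lemma sq_le_of_curvature_le {ξ h K κ c μ q r p D : ℝ} (hξ : 0 < ξ) (hh : 0 ≤ h)
    (hκ0 : 0 ≤ κ) (hc : c = 2 * h * κ + 2 * (ξ + h) * κ ^ 2) (hmu : 0 ≤ μ) (hmu1 : μ ≤ 1)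
    (hq0 : 0 ≤ q) (hq1 : q ≤ 1) (hp0 : 0 ≤ p) (hqs : q ≤ ξ / (8 * (c + 1)))
    (hw : p ≤ κ * (μ + q ^ 2)) (htri : q ≤ r + p)
    (hcurv : ξ * r ^ 2 ≤ D + 2 * h * (q * p) + h * p ^ 2) (hD : D ≤ K * μ + ξ / 8 * q ^ 2) :
    q ^ 2 ≤ (K + c) * (4 / ξ) * μ := by
  have hc0 : 0 ≤ c := by rw [hc]; positivity
  have hvq : q ^ 2 / 2 - p ^ 2 ≤ r ^ 2 := by
    nlinarith [sq_nonneg (r - p)]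
  have hqp : q * p ≤ κ * (μ + q * q ^ 2) := by
    calc q * p ≤ q * (κ * (μ + q ^ 2)) := by gcongr
      _ = κ * (q * μ + q * q ^ 2) := by ring
      _ ≤ κ * (μ + q * q ^ 2) := by gcongr; exact mul_le_of_le_one_left hmu hq1
  have hpp : p ^ 2 ≤ 2 * κ ^ 2 * (μ + q * q ^ 2) := by
    have e1 : μ ^ 2 ≤ μ := by nlinarith
    have e2 : (q ^ 2) ^ 2 ≤ q * q ^ 2 := by
      have : q * (q * q ^ 2) ≤ q * q ^ 2 := mul_le_of_le_one_left (by positivity) hq1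
      linarith
    calc p ^ 2 ≤ (κ * (μ + q ^ 2)) ^ 2 := by gcongr
      _ = κ ^ 2 * (μ + q ^ 2) ^ 2 := by ring
      _ ≤ κ ^ 2 * (2 * (μ + q * q ^ 2)) := by
        gcongr
        nlinarith [sq_nonneg (μ - q ^ 2)]
      _ = _ := by ring
  have hcq : c * (q * q ^ 2) ≤ ξ / 8 * q ^ 2 := by
    have : c * q ≤ ξ / 8 := by
      rw [le_div_iff₀ (by positivity)] at hqs
      nlinarith
    calc c * (q * q ^ 2) = c * q * q ^ 2 := by ring
      _ ≤ _ := by gcongr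
  have e1 : 2 * h * (q * p) + (ξ + h) * p ^ 2 ≤ c * (μ + q * q ^ 2) := by
    calc 2 * h * (q * p) + (ξ + h) * p ^ 2 ≤ 2 * h * (κ * (μ + q * q ^ 2)) +
        (ξ + h) * (2 * κ ^ 2 * (μ + q * q ^ 2)) := by gcongr
      _ = _ := by rw [hc]; ring
  have e2 : ξ * (q ^ 2 / 2 - p ^ 2) ≤ ξ * r ^ 2 := by gcongr
  have e3 : ξ / 4 * q ^ 2 ≤ (K + c) * μ := by linarith
  have e4 : (K + c) * (4 / ξ) * μ = (K + c) * μ * (4 / ξ) := by ring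
  rw [e4]
  calc q ^ 2 = ξ / 4 * q ^ 2 * (4 / ξ) := by field_simp
    _ ≤ _ := by gcongr

/-- Under strict complementarity, `zstar` is approached at the rate of the square root of the
duality measure. -/
lemma exists_sq_primal_distance_le (hfeas : ∀ i, P.g i zstar ≤ 0) (hmfcq : P.MFCQ zstar)
    (hsoc : P.SOC zstar) (hsc : P.StrictComp zstar) (hC : 0 < C) :
    ∃ K, 0 ≤ K ∧ ∃ ε, 0 < ε ∧ ∀ z lam ls s, P.NearCentral zstar C gam ε z lam ls s →
      ‖z - zstar‖ ^ 2 ≤ K * dmu lam s := by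
  obtain ⟨ξ, hξ, hsoc⟩ := hsoc
  obtain ⟨h, hh, hLzz⟩ := exists_Lzz_bound hmfcq
  obtain ⟨K₁, hK₁, hfirst⟩ := exists_curvature_add_slack_le (gam := gam) hfeas hmfcq hC
  obtain ⟨K₂, hK₂, ε₁, hε₁, hslack⟩ :=
    exists_active_slack_le_add_sq (gam := gam) hfeas hmfcq hsc hC
  obtain ⟨ε₂, hε₂, hfirst⟩ := hfirst (ξ / 8) (by positivity)
  let A : (Fin n → ℝ) →ₗ[ℝ] (Fin m → ℝ) := LinearMap.pi fun i =>
    if P.g i zstar = 0 then (dotCLM (P.gradg i zstar) : (Fin n → ℝ) →ₗ[ℝ] ℝ) else 0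
  have hA : ∀ x i, P.g i zstar = 0 → A x i = P.gradg i zstar ⬝ᵥ x := fun x i hi => by
    simp [A, hi, dotCLM_apply]
  have hA' : ∀ x i, P.g i zstar ≠ 0 → A x i = 0 := fun x i hi => by
    simp [A, hi]
  obtain ⟨K₃, hK₃, hker⟩ := exists_mem_ker_norm_sub_le A
  set κ : ℝ := K₃ * K₂ with hκ
  have hκ0 : 0 ≤ κ := by positivity
  set c : ℝ := 2 * h * κ + 2 * (ξ + h) * κ ^ 2 with hc
  have hc0 : 0 ≤ c := by positivity
  refine ⟨(K₁ + c) * (4 / ξ), by positivity,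
    min ε₁ (min ε₂ (min 1 (ξ / (8 * (c + 1))))), by positivity, ?_⟩
  intro z lam ls s hnear
  obtain ⟨h₁, h'⟩ := And.intro (hnear.mono (min_le_left _ _)) (hnear.mono (min_le_right _ _))
  obtain ⟨h₂, h'⟩ := And.intro (h'.mono (min_le_left _ _)) (h'.mono (min_le_right _ _))
  obtain ⟨h₃, h₄⟩ := And.intro (h'.mono (min_le_left _ _)) (h'.mono (min_le_right _ _))
  have hcen := hnear.central
  have hmem := hnear.mem
  have hmu := hcen.dmu_nonneg
  have hq1 := h₃.primal.le
  have hmu1 := h₃.dmu_le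
  have hqs := h₄.primal.le
  have hf := hfirst z lam ls s h₂
  have hact := fun i hi => (hslack z lam ls s h₁ i hi).2
  have hls_sum : 0 ≤ ∑ i, ls i * s i :=
    Finset.sum_nonneg fun i _ => mul_nonneg (hmem.2.2.1 i) (hcen.2.2.2.1 i).le
  set d := z - zstar with hd
  set μ := dmu lam s with hμ
  set q := ‖d‖ with hq
  have hq0 : 0 ≤ q := norm_nonneg _
  obtain ⟨v, hv, hdv⟩ := hker d
  have hAd : ‖A d‖ ≤ K₂ * (μ + q ^ 2) := by
    refine (pi_norm_le_iff_of_nonneg (by positivity)).2 fun i => ?_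
    by_cases hi : P.g i zstar = 0
    · rw [hA d i hi]
      exact hact i hi
    · rw [hA' d i hi, norm_zero]
      positivity
  have hw : ‖d - v‖ ≤ κ * (μ + q ^ 2) := by
    refine hdv.trans ?_
    rw [hκ, mul_assoc]
    gcongr
  have hcone : ξ * evnorm v ^ 2 ≤ v ⬝ᵥ P.Lzz zstar ls *ᵥ v :=
    hsoc ls hmem v
      (fun i hi => by
        have := hA v i hi.1
        rw [hv] at this
        exact this.symm)
      (fun i hi hnot => absurd (hsc i hi) hnot)
  have hvn : ‖v‖ ^ 2 ≤ evnorm v ^ 2 := by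
    gcongr
    exact norm_le_evnorm v
  set w := d - v with hw'
  set p := ‖w‖ with hp
  have hp0 : 0 ≤ p := norm_nonneg _
  have htri : q ≤ ‖v‖ + p := by
    have : d = v + w := by rw [hw']; abel
    rw [hq, this]
    exact norm_add_le _ _
  have hexp : v ⬝ᵥ P.Lzz zstar ls *ᵥ v ≤
      d ⬝ᵥ P.Lzz zstar ls *ᵥ d + 2 * h * (q * p) + h * p ^ 2 := by
    have hvd : v = d - w := by rw [hw']; abel
    have e1 := (abs_le.1 (hLzz ls hmem d w)).1
    have e2 := (abs_le.1 (hLzz ls hmem w d)).1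
    have e3 := (abs_le.1 (hLzz ls hmem w w)).2
    rw [hvd]
    simp only [mulVec_sub, sub_dotProduct, dotProduct_sub]
    simp only [← hp, ← hq] at e1 e2 e3
    linarith
  refine sq_le_of_curvature_le hξ hh hκ0 hc hmu hmu1 hq0 hq1 hp0 hqs hw htri
    (D := d ⬝ᵥ P.Lzz zstar ls *ᵥ d) ?_ (by linarith)
  exact (mul_le_mul_of_nonneg_left hvn hξ.le).trans (hcone.trans hexp)

/-- Under strict complementarity, slacks of active constraints are of the order of the duality
measure. -/
lemma exists_active_slack_le (hfeas : ∀ i, P.g i zstar ≤ 0) (hmfcq : P.MFCQ zstar)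
    (hsoc : P.SOC zstar) (hsc : P.StrictComp zstar) (hC : 0 < C) :
    ∃ K, 0 ≤ K ∧ ∃ ε, 0 < ε ∧ ∀ z lam ls s, P.NearCentral zstar C gam ε z lam ls s →
      ∀ i, P.g i zstar = 0 → s i ≤ K * dmu lam s := by
  obtain ⟨K₁, hK₁, ε₁, hε₁, h₁⟩ := exists_active_slack_le_add_sq (gam := gam) hfeas hmfcq hsc hC
  obtain ⟨K₂, hK₂, ε₂, hε₂, h₂⟩ :=
    exists_sq_primal_distance_le (gam := gam) hfeas hmfcq hsoc hsc hC
  refine ⟨K₁ * (1 + K₂), by positivity, min ε₁ ε₂, by positivity, ?_⟩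
  intro z lam ls s hnear i hi
  have e1 := (h₁ z lam ls s (hnear.mono (min_le_left _ _)) i hi).1
  have e2 := h₂ z lam ls s (hnear.mono (min_le_right _ _))
  calc s i ≤ K₁ * (dmu lam s + ‖z - zstar‖ ^ 2) := e1
    _ ≤ K₁ * (dmu lam s + K₂ * dmu lam s) := by gcongr
    _ = _ := by ring

end NLP

end

/-- Suppose `z*` is a solution at which MFCQ, the second-order
condition, and strict complementarity are satisfied, and fix `C > 0`, `γ ∈ (0,1)`.
Then there exist constants `c₁ ≥ c₀ > 0`, `μ̄ > 0` and a neighborhood `W` of `S` such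
that for every triple `(z,λ,s)` satisfying the approximate centrality conditions with
`(z,λ) ∈ W` and `μ = λᵀs/m ≤ μ̄`:  for all `i ∈ B`, `c₀μ ≤ s_i ≤ c₁μ` and
`c₀ ≤ λ_i ≤ c₁`; and for all `i ∈ N`, `c₀ ≤ s_i ≤ c₁` and `c₀μ ≤ λ_i ≤ c₁μ`. -/
theorem stmt3_basic_nonbasic_sizes
    {n m : ℕ} (P : NLP n m) (zstar : Fin n → ℝ)
    (hsol : P.isSolution zstar)
    (hmfcq : P.MFCQ zstar)
    (hsoc : P.SOC zstar)
    (hsc : P.StrictComp zstar)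
    (C gam : ℝ) (hC : 0 < C) (hgam0 : 0 < gam) (hgam1 : gam < 1) :
    ∃ c₀ c₁ : ℝ, 0 < c₀ ∧ c₀ ≤ c₁ ∧
      ∃ mubar : ℝ, 0 < mubar ∧
        ∃ W : Set ((Fin n → ℝ) × (Fin m → ℝ)), IsOpen W ∧
          (∀ ls ∈ P.Slam zstar, (zstar, ls) ∈ W) ∧
          ∀ z : Fin n → ℝ, ∀ lam s : Fin m → ℝ,
            (z, lam) ∈ W → P.central C gam z lam s → dmu lam s ≤ mubar →
            (∀ i, P.g i zstar = 0 →
              c₀ * dmu lam s ≤ s i ∧ s i ≤ c₁ * dmu lam s ∧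
              c₀ ≤ lam i ∧ lam i ≤ c₁) ∧
            (∀ i, P.g i zstar ≠ 0 →
              c₀ ≤ s i ∧ s i ≤ c₁ ∧
              c₀ * dmu lam s ≤ lam i ∧ lam i ≤ c₁ * dmu lam s) := by
  obtain ⟨M, hM, hbound⟩ := hmfcq.exists_multiplier_le
  obtain ⟨a, b, ε₁, ha, hab, hε₁, hinact⟩ :=
    NLP.exists_inactive_slack_bounds (gam := gam) hsol.1 hC
  obtain ⟨K, hK, ε₂, hε₂, hact⟩ :=
    NLP.exists_active_slack_le (gam := gam) hsol.1 hmfcq hsoc hsc hC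
  set ε := min (min ε₁ ε₂) 1 with hε
  have hε0 : 0 < ε := by positivity
  have hb : 0 < b := ha.trans_le hab
  have hc₀ : ∃ c, 0 < c ∧ c ≤ a ∧ c ≤ gam / (M + 1) ∧ c ≤ gam / (K + 1) ∧ c ≤ gam / b :=
    ⟨min (min a (gam / (M + 1))) (min (gam / (K + 1)) (gam / b)), by positivity,
      (min_le_left _ _).trans (min_le_left _ _), (min_le_left _ _).trans (min_le_right _ _),
      (min_le_right _ _).trans (min_le_left _ _), (min_le_right _ _).trans (min_le_right _ _)⟩
  obtain ⟨c, hc, hca, hcM, hcK, hcb⟩ := hc₀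
  have hma : (0 : ℝ) ≤ m / a := by positivity
  refine ⟨c, K + 1 + (M + 1) + b + m / a, hc, by linarith, ε, hε0,
    {x | ∃ ls ∈ P.Slam zstar, ‖x.1 - zstar‖ < ε ∧ ‖x.2 - ls‖ < ε}, ?_, ?_, ?_⟩
  · have : {x : (Fin n → ℝ) × (Fin m → ℝ) |
        ∃ ls ∈ P.Slam zstar, ‖x.1 - zstar‖ < ε ∧ ‖x.2 - ls‖ < ε} =
        ⋃ ls ∈ P.Slam zstar, {x | ‖x.1 - zstar‖ < ε ∧ ‖x.2 - ls‖ < ε} := by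
      ext x; simp only [Set.mem_ofPred_eq, Set.mem_iUnion, exists_prop]
    rw [this]
    refine isOpen_biUnion fun ls _ => IsOpen.and ?_ ?_ <;>
      exact isOpen_lt (by fun_prop) continuous_const
  · intro ls hls
    exact ⟨ls, hls, by simpa using hε0, by simpa using hε0⟩
  · rintro z lam s ⟨ls, hls, hz, hlam⟩ hcen hmu
    have hnear : P.NearCentral zstar C gam ε z lam ls s := ⟨hls, hz, hlam, hcen, hmu⟩
    have hin := hinact z lam ls s (hnear.mono ((min_le_left _ _).trans (min_le_left _ _)))
    have hac := hact z lam ls s (hnear.mono ((min_le_left _ _).trans (min_le_right _ _)))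
    have hd := (hnear.mono (min_le_right _ _)).dual.le
    have hmul := hcen.mul_le
    have hmu0 := hcen.dmu_nonneg
    obtain ⟨-, -, hl0, hs0, hgam⟩ := hcen
    set μ := dmu lam s
    have hlM : ∀ i, lam i ≤ M + 1 := fun i => by
      have e1 := (abs_le.1 ((abs_apply_le_norm (lam - ls) i).trans hd)).2
      have e2 := hbound i ls hls
      simp only [Pi.sub_apply] at e1
      linarith
    have hKμ : 0 ≤ K * μ := by positivity
    have hMμ : 0 ≤ M * μ := by positivity
    have hbμ : 0 ≤ b * μ := by positivity
    have haμ : 0 ≤ m / a * μ := by positivity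
    refine ⟨fun i hi => ?_, fun i hi => ?_⟩
    · have hsi := hac i hi
      have hμ : 0 < μ := by
        by_contra hneg
        have : μ = 0 := le_antisymm (not_lt.1 hneg) hmu0
        rw [this, mul_zero] at hsi
        exact (hs0 i).not_ge hsi
      refine ⟨?_, by linarith, ?_, by linarith [hlM i]⟩
      · rw [le_div_iff₀ (by linarith)] at hcM
        nlinarith [hgam i, hlM i, hs0 i]
      · rw [le_div_iff₀ (by linarith)] at hcK
        nlinarith [hgam i, hl0 i]
    · obtain ⟨hsa, hsb⟩ := hin i hi
      refine ⟨by linarith, by linarith, ?_, ?_⟩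
      · have e1 : c * μ ≤ gam / b * μ := by gcongr
        refine e1.trans ?_
        rw [div_mul_eq_mul_div, div_le_iff₀ hb]
        exact (hgam i).trans (mul_le_mul_of_nonneg_left hsb (hl0 i).le)
      · have e1 : lam i ≤ m / a * μ := by
          rw [div_mul_eq_mul_div, le_div_iff₀ ha]
          exact (mul_le_mul_of_nonneg_left hsa (hl0 i).le).trans (hmul i)
        linarith
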